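/- Every McNaughton homeomorphism S of [0,1]^n preserves the Lebesgue measure on [0,1]^n: for every Borel set E ⊆ [0,1]^n, the Lebesgue measure of S⁻¹(E) equals the Lebesgue measure of E. -/

import Mathlib

/-- The unit cube `[0,1]^n` inside `Fin n → ℝ`. -/
def unitCube (n : ℕ) : Set (Fin n → ℝ) := Set.univ.pi fun _ => Set.Icc (0:ℝ) 1

/-- A McNaughton function in `n` variables: a continuous function
`[0,1]^n → [0,1]` which, at every point of the cube, agrees with one of
finitely many affine polynomials with integer coefficients. -/
def IsMcNaughtonFn {n : ℕ} (f : (Fin n → ℝ) → ℝ) : Prop :=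
  ContinuousOn f (unitCube n) ∧
  Set.MapsTo f (unitCube n) (Set.Icc (0:ℝ) 1) ∧
  ∃ (m : ℕ) (a : Fin m → Fin n → ℤ) (b : Fin m → ℤ),
    ∀ x ∈ unitCube n, ∃ j : Fin m,
      f x = (∑ i : Fin n, (a j i : ℝ) * x i) + (b j : ℝ)

/-- A McNaughton mapping of `[0,1]^n`: each coordinate is a McNaughton
function. -/
def IsMcNaughtonMap {n : ℕ} (S : (Fin n → ℝ) → (Fin n → ℝ)) : Prop :=
  ∀ i : Fin n, IsMcNaughtonFn (fun x => S x i)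

/-- A McNaughton homeomorphism of `[0,1]^n`: a McNaughton mapping which is a
bijection of the cube onto itself whose inverse is also a McNaughton mapping. -/
def IsMcNaughtonHomeo {n : ℕ} (S : (Fin n → ℝ) → (Fin n → ℝ)) : Prop :=
  IsMcNaughtonMap S ∧ ∃ T : (Fin n → ℝ) → (Fin n → ℝ), IsMcNaughtonMap T ∧
    (∀ x ∈ unitCube n, T (S x) = x) ∧ (∀ x ∈ unitCube n, S (T x) = x)

/-- `p ∈ [0,1]^n` has `d` as a denominator: `d > 0` and `d • p ∈ ℤ^n`. -/
def IsDenom {n : ℕ} (p : Fin n → ℝ) (d : ℕ) : Prop :=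
  0 < d ∧ ∀ i : Fin n, ∃ z : ℤ, (d : ℝ) * p i = (z : ℝ)

/-- The denominator of a point: the least positive integer `d` with
`d • p ∈ ℤ^n` (junk value `0` if there is none). -/
noncomputable def den {n : ℕ} (p : Fin n → ℝ) : ℕ := sInf {d | IsDenom p d}

open MeasureTheory

/-- The affine map `x ↦ A x + b` of `ℝ^n` with integer coefficients. -/
def intAffine {n : ℕ} (A : Matrix (Fin n) (Fin n) ℤ) (b : Fin n → ℤ) (x : Fin n → ℝ) :
    Fin n → ℝ :=
  (A.map (Int.cast : ℤ → ℝ)).mulVec x + fun i => (b i : ℝ)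

theorem continuous_intAffine {n : ℕ} (A : Matrix (Fin n) (Fin n) ℤ) (b : Fin n → ℤ) :
    Continuous (intAffine A b) :=
  (Continuous.matrix_mulVec continuous_const continuous_id).add continuous_const

theorem volume_image_intAffine {n : ℕ} (A : Matrix (Fin n) (Fin n) ℤ) (b : Fin n → ℤ)
    (E : Set (Fin n → ℝ)) :
    volume (intAffine A b '' E) = ENNReal.ofReal |(A.det : ℝ)| * volume E := by
  have himage : intAffine A b '' E =
      (fun y => y + fun i => (b i : ℝ)) '' (Matrix.toLin' (A.map (Int.cast : ℤ → ℝ)) '' E) := by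
    rw [Set.image_image]
    rfl
  have hdet : (A.map (Int.cast : ℤ → ℝ)).det = (A.det : ℝ) :=
    ((Int.castRingHom ℝ).map_det A).symm
  rw [himage, Set.image_add_right, measure_preimage_add_right, Measure.addHaar_image_linearMap,
    LinearMap.det_toLin', hdet]

theorem isClosed_unitCube (n : ℕ) : IsClosed (unitCube n) :=
  isClosed_set_pi fun _ _ => isClosed_Icc

namespace IsMcNaughtonMap

variable {n : ℕ} {S T : (Fin n → ℝ) → (Fin n → ℝ)}

theorem continuousOn (hS : IsMcNaughtonMap S) : ContinuousOn S (unitCube n) :=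
  continuousOn_pi.2 fun i => (hS i).1

theorem mapsTo (hS : IsMcNaughtonMap S) : Set.MapsTo S (unitCube n) (unitCube n) :=
  fun _ hx i _ => (hS i).2.1 hx

/-- A McNaughton mapping is piecewise affine, with finitely many integer affine pieces. -/
theorem exists_finset_intAffine (hS : IsMcNaughtonMap S) :
    ∃ P : Finset (Matrix (Fin n) (Fin n) ℤ × (Fin n → ℤ)),
      ∀ x ∈ unitCube n, ∃ p ∈ P, S x = intAffine p.1 p.2 x := by
  classical
  choose m a b h using fun i => (hS i).2.2
  refine ⟨Finset.univ.image fun J : (i : Fin n) → Fin (m i) =>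
    (Matrix.of fun i => a i (J i), fun i => b i (J i)), fun x hx => ?_⟩
  choose J hJ using fun i => h i x hx
  exact ⟨_, Finset.mem_image_of_mem _ (Finset.mem_univ J), funext hJ⟩

theorem volume_image_eq_zero (hS : IsMcNaughtonMap S) {N : Set (Fin n → ℝ)}
    (hN : N ⊆ unitCube n) (h0 : volume N = 0) : volume (S '' N) = 0 := by
  obtain ⟨P, hP⟩ := hS.exists_finset_intAffine
  have hsub : S '' N ⊆ ⋃ p ∈ P, intAffine p.1 p.2 '' N := by
    rintro _ ⟨x, hx, rfl⟩
    obtain ⟨p, hp, hpx⟩ := hP x (hN hx)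
    exact Set.mem_biUnion hp ⟨x, hx, hpx.symm⟩
  refine measure_mono_null hsub ((measure_biUnion_null_iff P.countable_toSet).2 fun p _ => ?_)
  rw [volume_image_intAffine, h0, mul_zero]

/-- On a set where it is affine, a McNaughton mapping with a McNaughton left inverse does not
decrease volume: its integer determinant is nonzero unless the set is null. -/
theorem volume_le_volume_image_of_eqOn (hS : IsMcNaughtonMap S) (hT : IsMcNaughtonMap T)
    (hTS : ∀ x ∈ unitCube n, T (S x) = x) {A : Matrix (Fin n) (Fin n) ℤ} {b : Fin n → ℤ}
    {E : Set (Fin n → ℝ)} (hE : E ⊆ unitCube n) (hEq : Set.EqOn S (intAffine A b) E) :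
    volume E ≤ volume (S '' E) := by
  have hvol : volume (S '' E) = ENNReal.ofReal |(A.det : ℝ)| * volume E := by
    rw [hEq.image_eq, volume_image_intAffine]
  by_cases hdet : A.det = 0
  · have hnull : volume (S '' E) = 0 := by simp [hvol, hdet]
    have hback : T '' (S '' E) = E := by
      rw [Set.image_image]
      exact (Set.EqOn.image_eq fun x hx => hTS x (hE hx)).trans (Set.image_id' E)
    have hzero := hT.volume_image_eq_zero ((hS.mapsTo.mono_left hE).image_subset) hnull
    rw [hback] at hzero
    exact hzero.trans_le zero_le
  · rw [hvol]
    refine le_mul_of_one_le_left zero_le (ENNReal.one_le_ofReal.2 ?_)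
    exact_mod_cast Int.one_le_abs hdet

theorem volume_le_volume_image (hS : IsMcNaughtonMap S) (hT : IsMcNaughtonMap T)
    (hTS : ∀ x ∈ unitCube n, T (S x) = x) {E : Set (Fin n → ℝ)} (hEm : MeasurableSet E)
    (hE : E ⊆ unitCube n) : volume E ≤ volume (S '' E) := by
  classical
  have hinj : Set.InjOn S (unitCube n) := Set.LeftInvOn.injOn (f₁' := T) hTS
  obtain ⟨P, hP⟩ := hS.exists_finset_intAffine
  replace hP : ∀ x ∈ E, ∃ p ∈ P, S x = intAffine p.1 p.2 x := fun x hx => hP x (hE hx)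
  induction P using Finset.induction_on generalizing E with
  | empty =>
    have : E = ∅ := Set.eq_empty_of_forall_notMem fun x hx => by simpa using hP x hx
    simp [this]
  | insert p P _ ih =>
    set C : Set (Fin n → ℝ) := unitCube n ∩ (fun x => S x - intAffine p.1 p.2 x) ⁻¹' {0}
    have hCm : MeasurableSet C :=
      (ContinuousOn.preimage_isClosed_of_isClosed
        (hS.continuousOn.sub (continuous_intAffine p.1 p.2).continuousOn)
        (isClosed_unitCube n) isClosed_singleton).measurableSet
    have hdiff : E \ C ⊆ unitCube n := Set.sdiff_subset.trans hE
    have hinter : E ∩ C ⊆ unitCube n := Set.inter_subset_left.trans hE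
    have hmeas : MeasurableSet (S '' (E \ C)) :=
      (hEm.diff hCm).image_of_continuousOn_injOn (hS.continuousOn.mono hdiff) (hinj.mono hdiff)
    have hdisj : Disjoint (S '' (E ∩ C)) (S '' (E \ C)) :=
      Set.disjoint_sdiff_right.mono_left Set.inter_subset_right |>.image hinj hinter hdiff
    calc volume E = volume (E ∩ C) + volume (E \ C) := (measure_inter_add_sdiff E hCm).symm
      _ ≤ volume (S '' (E ∩ C)) + volume (S '' (E \ C)) := by
        refine add_le_add (hS.volume_le_volume_image_of_eqOn hT hTS hinter
          (A := p.1) (b := p.2) fun x hx => sub_eq_zero.1 hx.2.2) ?_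
        refine ih (hEm.diff hCm) hdiff fun x hx => ?_
        obtain ⟨q, hq, hqx⟩ := hP x hx.1
        rcases Finset.mem_insert.1 hq with rfl | hq
        · exact absurd ⟨hE hx.1, sub_eq_zero.2 hqx⟩ hx.2
        · exact ⟨q, hq, hqx⟩
      _ = volume (S '' E) := by
        rw [← measure_union hdisj hmeas, ← Set.image_union, Set.inter_union_sdiff]

end IsMcNaughtonMap

/-- Every McNaughton homeomorphism of `[0,1]^n` preserves Lebesgue measure:
for every Borel set `E ⊆ [0,1]^n`, the measure of its preimage (within the
cube) equals the measure of `E`. -/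
theorem mcnaughton_homeo_measure_preserving {n : ℕ}
    (S : (Fin n → ℝ) → (Fin n → ℝ)) (hS : IsMcNaughtonHomeo S) :
    ∀ E : Set (Fin n → ℝ), MeasurableSet E → E ⊆ unitCube n →
      volume (S ⁻¹' E ∩ unitCube n) = volume E := by
  obtain ⟨hS, T, hT, hTS, hST⟩ := hS
  intro E hEm hE
  have hpre : S ⁻¹' E ∩ unitCube n = T '' E := by
    ext x
    constructor
    · rintro ⟨hx, hxc⟩
      exact ⟨S x, hx, hTS x hxc⟩
    · rintro ⟨y, hy, rfl⟩
      exact ⟨by simpa [hST y (hE hy)] using hy, hT.mapsTo (hE hy)⟩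
  have himage : S '' (T '' E) = E := by
    rw [Set.image_image]
    exact (Set.EqOn.image_eq fun x hx => hST x (hE hx)).trans (Set.image_id' E)
  have hmeas : MeasurableSet (T '' E) :=
    hEm.image_of_continuousOn_injOn (hT.continuousOn.mono hE)
      ((Set.LeftInvOn.injOn (f₁' := S) hST).mono hE)
  rw [hpre]
  refine le_antisymm ?_ (hT.volume_le_volume_image hS hST hEm hE)
  have hle := hS.volume_le_volume_image hT hTS hmeas ((hT.mapsTo.mono_left hE).image_subset)
  rwa [himage] at hle
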